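/- arXiv:2007.10171 — 4 statements merged into one kernel-verified Lean document; each statement's English description precedes it below -/
import Mathlib

section
/- Let γ ∈ (0,1/2) and 0 < ε < γ. Then the function η ↦ 𝒟^{γ−ε}(|ξ|^{γ−1/2} ϕ₀(ξ))(η), i.e. η ↦ (∫_ℝ (|y|^{γ−1/2}ϕ₀(y) − |η|^{γ−1/2}ϕ₀(η))² / |y−η|^{1+2(γ−ε)} dy)^{1/2}, belongs to L²(ℝ). -/
open MeasureTheory Real Set
open scoped ENNReal

noncomputable section

lemma lintegral_comp_abs_le (g : ℝ → ℝ≥0∞) :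
    ∫⁻ x : ℝ, g |x| ≤ 2 * ∫⁻ x in Ioi (0 : ℝ), g x := by
  have hpos : ∫⁻ x in Ioi (0 : ℝ), g |x| = ∫⁻ x in Ioi (0 : ℝ), g x :=
    setLIntegral_congr_fun measurableSet_Ioi fun x hx => by
      simp only [abs_of_pos (mem_Ioi.1 hx)]
  have hneg : ∫⁻ x in Iic (0 : ℝ), g |x| = ∫⁻ x in Ioi (0 : ℝ), g x := by
    have h := (Measure.measurePreserving_neg (volume : Measure ℝ)).setLIntegral_comp_preimage_emb
      (Homeomorph.neg ℝ).measurableEmbedding (fun x => g |x|) (Ici 0)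
    simp only [abs_neg, neg_preimage, neg_Ici, neg_zero] at h
    rw [h, setLIntegral_congr Ioi_ae_eq_Ici.symm, hpos]
  calc ∫⁻ x : ℝ, g |x| = ∫⁻ x in Iic (0 : ℝ) ∪ Ioi 0, g |x| := by
        rw [Iic_union_Ioi, Measure.restrict_univ]
    _ ≤ (∫⁻ x in Iic (0 : ℝ), g |x|) + ∫⁻ x in Ioi (0 : ℝ), g |x| := lintegral_union_le _ _ _
    _ = 2 * ∫⁻ x in Ioi (0 : ℝ), g x := by rw [hpos, hneg, two_mul]

lemma lintegral_indicator_Ici_abs_rpow_le {p r : ℝ} (hp : p < -1) (hr : 0 < r) :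
    ∫⁻ y : ℝ, (Ici r).indicator (fun t => ENNReal.ofReal (t ^ p)) |y| ≤
      2 * ENNReal.ofReal (-r ^ (p + 1) / (p + 1)) := by
  refine (lintegral_comp_abs_le _).trans ?_
  gcongr
  rw [setLIntegral_indicator measurableSet_Ici,
    inter_eq_left.2 (Ici_subset_Ioi.2 hr), setLIntegral_congr Ioi_ae_eq_Ici.symm,
    ← integral_Ioi_rpow_of_lt hp hr,
    ofReal_integral_eq_lintegral_ofReal (integrableOn_Ioi_rpow_of_lt hp hr)]
  filter_upwards [ae_restrict_mem measurableSet_Ioi] with t ht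
  exact rpow_nonneg (hr.le.trans (le_of_lt ht)) _

lemma lintegral_indicator_Iio_abs_rpow_lt_top {q r : ℝ} (hq : -1 < q) (hr : 0 < r) :
    ∫⁻ x : ℝ, (Iio r).indicator (fun t => ENNReal.ofReal (t ^ q)) |x| < ⊤ := by
  refine (lintegral_comp_abs_le _).trans_lt (ENNReal.mul_lt_top (by simp) ?_)
  rw [setLIntegral_indicator measurableSet_Iio, inter_comm, Ioi_inter_Iio]
  exact Integrable.lintegral_lt_top
    ((intervalIntegral.integrableOn_Ioo_rpow_iff hr).2 hq)

lemma abs_rpow_sub_rpow_le {a u v : ℝ} (ha : -1 ≤ a) (ha0 : a ≤ 0) (hu : 0 < u) (huv : u ≤ v) :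
    |v ^ a - u ^ a| ≤ u ^ a * ((v - u) / v) := by
  have hv : 0 < v := hu.trans_le huv
  have hle : v ^ a ≤ u ^ a := rpow_le_rpow_of_nonpos hu huv ha0
  have hlow : u ^ a * (u / v) ≤ v ^ a := by
    have h1 : (v / u) ^ (-1 : ℝ) ≤ (v / u) ^ a :=
      rpow_le_rpow_of_exponent_le ((one_le_div hu).2 huv) ha
    rw [rpow_neg_one, inv_div, div_rpow hv.le hu.le, le_div_iff₀ (rpow_pos_of_pos hu a)] at h1
    linarith
  rw [abs_sub_comm, abs_of_nonneg (sub_nonneg.2 hle), sub_div, div_self hv.ne', mul_sub, mul_one]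
  linarith

/-- The kernel that dominates the Gagliardo integrand of a truncated negative power. -/
def dominatingKernel (R q p : ℝ) (x y : ℝ) : ℝ≥0∞ :=
  {z : ℝ × ℝ | |z.1| < R ∧ |z.1| ≤ |z.2|}.indicator
    (fun z => ENNReal.ofReal (|z.1| ^ q) * ENNReal.ofReal (|z.2| ^ p)) (x, y)

lemma measurable_dominatingKernel (R q p : ℝ) :
    Measurable (Function.uncurry (dominatingKernel R q p)) := by
  refine Measurable.indicator (by fun_prop) ?_
  have h1 : Measurable fun z : ℝ × ℝ => |z.1| := by fun_prop
  have h2 : Measurable fun z : ℝ × ℝ => |z.2| := by fun_prop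
  exact (measurableSet_lt h1 measurable_const).inter (measurableSet_le h1 h2)

lemma lintegral_lintegral_dominatingKernel_lt_top {R q p : ℝ} (hR : 0 < R) (hp : p < -1)
    (hqp : -1 < q + (p + 1)) :
    ∫⁻ x : ℝ, ∫⁻ y : ℝ, dominatingKernel R q p x y < ⊤ := by
  have hbound : ∀ᵐ x : ℝ, ∫⁻ y : ℝ, dominatingKernel R q p x y ≤
      (2 * ENNReal.ofReal (-1 / (p + 1))) *
        (Iio R).indicator (fun t => ENNReal.ofReal (t ^ (q + (p + 1)))) |x| := by
    filter_upwards [Measure.ae_ne volume (0 : ℝ)] with x hx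
    have hx' : 0 < |x| := abs_pos.2 hx
    by_cases hxR : |x| < R
    · have hker : ∀ y, dominatingKernel R q p x y = ENNReal.ofReal (|x| ^ q) *
          (Ici |x|).indicator (fun t => ENNReal.ofReal (t ^ p)) |y| := by
        intro y
        by_cases hxy : |x| ≤ |y| <;> simp [dominatingKernel, indicator, hxR, hxy]
      simp_rw [hker]
      rw [lintegral_const_mul' _ _ ENNReal.ofReal_ne_top, indicator_of_mem (mem_Iio.2 hxR)]
      refine (mul_le_mul_right (lintegral_indicator_Ici_abs_rpow_le hp hx') _).trans_eq ?_
      rw [rpow_add hx' q, mul_left_comm, mul_assoc, ← ENNReal.ofReal_mul (by positivity),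
        ← ENNReal.ofReal_mul (div_nonneg_of_nonpos (by norm_num) (by linarith))]
      congr 2
      ring
    · simp [dominatingKernel, indicator, hxR]
  refine (lintegral_mono_ae hbound).trans_lt ?_
  rw [lintegral_const_mul' _ _ (by finiteness)]
  exact ENNReal.mul_lt_top (by finiteness) (lintegral_indicator_Iio_abs_rpow_lt_top hqp hR)

lemma exists_abs_mul_abs_sub_le {φ : ℝ → ℝ} (hφ : ContDiff ℝ 1 φ) (hc : HasCompactSupport φ) :
    ∃ M K : ℝ, (∀ x, |φ x| ≤ M) ∧
      ∀ x y, |y| * |φ y - φ x| ≤ K * |y - x| := by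
  obtain ⟨M, hM⟩ := hφ.continuous.bounded_above_of_compact_support hc
  simp only [norm_eq_abs] at hM
  have hψ : ContDiff ℝ 1 fun x => x * φ x := contDiff_id.mul hφ
  have hψc : HasCompactSupport fun x => x * φ x := hc.mul_left (f := fun x => x)
  obtain ⟨L, hL⟩ := hψ.lipschitzWith_of_hasCompactSupport hψc one_ne_zero
  refine ⟨M, L + M, hM, fun x y => ?_⟩
  have h1 : |y * φ y - x * φ x| ≤ L * |y - x| := by
    simpa [Real.dist_eq] using hL.dist_le_mul y x
  calc |y| * |φ y - φ x| = |(y * φ y - x * φ x) - (y - x) * φ x| := by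
        rw [← abs_mul]; congr 1; ring
    _ ≤ |y * φ y - x * φ x| + |y - x| * |φ x| := by
        rw [← abs_mul]; exact abs_sub _ _
    _ ≤ L * |y - x| + |y - x| * M := by gcongr; exact hM x
    _ = (L + M) * |y - x| := by ring

lemma abs_rpow_mul_sub_le {a M K : ℝ} {φ : ℝ → ℝ} (ha : -1 ≤ a) (ha0 : a ≤ 0)
    (hM : ∀ x, |φ x| ≤ M) (hK : ∀ x y, |y| * |φ y - φ x| ≤ K * |y - x|)
    {x y : ℝ} (hx : x ≠ 0) (hxy : |x| ≤ |y|) :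
    |(|y| ^ a * φ y - |x| ^ a * φ x)| ≤ (K + M) * (|x| ^ a * (|y - x| / |y|)) := by
  have hx' : 0 < |x| := abs_pos.2 hx
  have hy' : 0 < |y| := hx'.trans_le hxy
  have h1 : |φ y - φ x| ≤ K * (|y - x| / |y|) := by
    rw [← mul_div_assoc, le_div_iff₀ hy', mul_comm]
    exact hK x y
  have h2 : |(|y| ^ a - |x| ^ a)| ≤ |x| ^ a * (|y - x| / |y|) := by
    refine (abs_rpow_sub_rpow_le ha ha0 hx' hxy).trans ?_
    gcongr
    exact abs_sub_abs_le_abs_sub y x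
  have h3 : |y| ^ a ≤ |x| ^ a := rpow_le_rpow_of_nonpos hx' hxy ha0
  calc |(|y| ^ a * φ y - |x| ^ a * φ x)|
      = |(|y| ^ a * (φ y - φ x) + (|y| ^ a - |x| ^ a) * φ x)| := by congr 1; ring
    _ ≤ |y| ^ a * |φ y - φ x| + |(|y| ^ a - |x| ^ a)| * |φ x| := by
        refine (abs_add_le _ _).trans_eq ?_
        rw [abs_mul, abs_mul, abs_of_nonneg (rpow_nonneg (abs_nonneg y) a)]
    _ ≤ |x| ^ a * (K * (|y - x| / |y|)) + (|x| ^ a * (|y - x| / |y|)) * M := by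
        gcongr
        exact hM x
    _ = (K + M) * (|x| ^ a * (|y - x| / |y|)) := by ring

lemma sq_div_rpow_le {a s C D : ℝ} (hs : s < 1 / 2) {x y : ℝ} (hx : x ≠ 0) (hxy : |x| ≤ |y|)
    (hD : |D| ≤ C * (|x| ^ a * (|y - x| / |y|))) :
    D ^ 2 / |y - x| ^ (1 + 2 * s) ≤
      C ^ 2 * 2 ^ (1 - 2 * s) * (|x| ^ (2 * a) * |y| ^ (-1 - 2 * s)) := by
  have hx' : 0 < |x| := abs_pos.2 hx
  have hy' : 0 < |y| := hx'.trans_le hxy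
  rcases (abs_nonneg (y - x)).eq_or_lt with hd | hd
  · rw [← hd, zero_div, mul_zero, mul_zero] at hD
    rw [abs_nonpos_iff.1 hD]
    simp only [ne_eq, OfNat.ofNat_ne_zero, not_false_eq_true, zero_pow, zero_div]
    positivity
  · have hle : |y - x| ≤ 2 * |y| := by linarith [abs_sub y x]
    calc D ^ 2 / |y - x| ^ (1 + 2 * s)
        ≤ (C * (|x| ^ a * (|y - x| / |y|))) ^ 2 / |y - x| ^ (1 + 2 * s) := by
          rw [← sq_abs D]; gcongr
      _ = C ^ 2 * |x| ^ (2 * a) * |y - x| ^ (1 - 2 * s) / |y| ^ 2 := by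
          have e1 : |x| ^ (2 * a) = (|x| ^ a) ^ 2 := by
            rw [mul_comm, rpow_mul hx'.le, rpow_two]
          have e2 : |y - x| ^ (1 - 2 * s) = |y - x| ^ 2 / |y - x| ^ (1 + 2 * s) := by
            rw [← rpow_two, ← rpow_sub hd]; congr 1; ring
          rw [e1, e2]; ring
      _ ≤ C ^ 2 * |x| ^ (2 * a) * (2 * |y|) ^ (1 - 2 * s) / |y| ^ 2 := by
          gcongr
          linarith
      _ = C ^ 2 * 2 ^ (1 - 2 * s) * (|x| ^ (2 * a) * |y| ^ (-1 - 2 * s)) := by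
          have e : |y| ^ (-1 - 2 * s) = |y| ^ (1 - 2 * s) / |y| ^ 2 := by
            rw [← rpow_two, ← rpow_sub hy']; congr 1; ring
          rw [e, mul_rpow zero_le_two hy'.le]; ring

lemma ofReal_sq_div_rpow_le_dominatingKernel {a s M K R : ℝ} {φ : ℝ → ℝ} (ha : -1 ≤ a)
    (ha0 : a ≤ 0) (hs : s < 1 / 2) (hM : ∀ x, |φ x| ≤ M)
    (hK : ∀ x y, |y| * |φ y - φ x| ≤ K * |y - x|) (hR : ∀ x, R ≤ |x| → φ x = 0)
    {x y : ℝ} (hx : x ≠ 0) (hxy : |x| ≤ |y|) :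
    ENNReal.ofReal ((|y| ^ a * φ y - |x| ^ a * φ x) ^ 2 / |y - x| ^ (1 + 2 * s)) ≤
      ENNReal.ofReal ((K + M) ^ 2 * 2 ^ (1 - 2 * s)) *
        dominatingKernel R (2 * a) (-1 - 2 * s) x y := by
  by_cases hxR : |x| < R
  · rw [dominatingKernel, indicator_of_mem (by exact ⟨hxR, hxy⟩),
      ← ENNReal.ofReal_mul (by positivity), ← ENNReal.ofReal_mul (by positivity)]
    exact ENNReal.ofReal_le_ofReal
      (sq_div_rpow_le hs hx hxy (abs_rpow_mul_sub_le ha ha0 hM hK hx hxy))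
  · have hRx := not_lt.1 hxR
    simp [hR x hRx, hR y (hRx.trans hxy)]

/-- Proposition 2.10: for γ ∈ (0,1/2) and 0 < ε < γ, the Stein derivative of order γ−ε of
|ξ|^{γ−1/2}ϕ₀(ξ) belongs to L²(ℝ). -/
theorem steinDeriv_rpow_cutoff_memL2
    (γ ε : ℝ) (hγ : γ ∈ Ioo (0 : ℝ) (1 / 2)) (hε : 0 < ε) (hεγ : ε < γ)
    (ϕ₀ : ℝ → ℝ) (hϕ_smooth : ContDiff ℝ (⊤ : ℕ∞) ϕ₀)
    (hϕ_supp : tsupport ϕ₀ ⊆ Icc (-2 : ℝ) 2)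
    (hϕ_one : ∀ x ∈ Ioo (-1 : ℝ) 1, ϕ₀ x = 1) :
    ∫⁻ η : ℝ,
        ((∫⁻ y : ℝ, ENNReal.ofReal
            ((|y| ^ (γ - 1 / 2) * ϕ₀ y - |η| ^ (γ - 1 / 2) * ϕ₀ η) ^ 2 /
              |y - η| ^ (1 + 2 * (γ - ε)))) ^ (1 / 2 : ℝ)) ^ 2 < ⊤ := by
  obtain ⟨hγ0, hγ1⟩ := hγ
  have hc : HasCompactSupport ϕ₀ := isCompact_Icc.of_isClosed_subset (isClosed_tsupport _) hϕ_supp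
  obtain ⟨M, K, hM, hK⟩ := exists_abs_mul_abs_sub_le (hϕ_smooth.of_le (by simp)) hc
  have hR : ∀ x : ℝ, 3 ≤ |x| → ϕ₀ x = 0 := fun x hx => by
    refine image_eq_zero_of_notMem_tsupport fun hmem => ?_
    have := abs_le.2 (mem_Icc.1 (hϕ_supp hmem))
    linarith
  set C := ENNReal.ofReal ((K + M) ^ 2 * 2 ^ (1 - 2 * (γ - ε)))
  set G := dominatingKernel 3 (2 * (γ - 1 / 2)) (-1 - 2 * (γ - ε))
  have hGmeas : Measurable (Function.uncurry G) := measurable_dominatingKernel _ _ _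
  have hG : ∫⁻ x : ℝ, ∫⁻ y : ℝ, G x y < ⊤ :=
    lintegral_lintegral_dominatingKernel_lt_top (by norm_num) (by linarith) (by linarith)
  have hG' : ∫⁻ x : ℝ, ∫⁻ y : ℝ, G y x < ⊤ := by
    rwa [lintegral_lintegral_swap hGmeas.aemeasurable] at hG
  have hpt : ∀ x y : ℝ, x ≠ 0 → |x| ≤ |y| →
      ENNReal.ofReal ((|y| ^ (γ - 1 / 2) * ϕ₀ y - |x| ^ (γ - 1 / 2) * ϕ₀ x) ^ 2 /
        |y - x| ^ (1 + 2 * (γ - ε))) ≤ C * G x y := fun x y hx hxy =>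
    ofReal_sq_div_rpow_le_dominatingKernel (by linarith) (by linarith) (by linarith) hM hK hR hx hxy
  have hsum : ∀ x : ℝ, x ≠ 0 → ∀ y : ℝ, y ≠ 0 →
      ENNReal.ofReal ((|y| ^ (γ - 1 / 2) * ϕ₀ y - |x| ^ (γ - 1 / 2) * ϕ₀ x) ^ 2 /
        |y - x| ^ (1 + 2 * (γ - ε))) ≤ C * (G x y + G y x) := by
    intro x hx y hy
    rcases le_total |x| |y| with h | h
    · exact (hpt x y hx h).trans (by gcongr; exact le_self_add)
    · rw [abs_sub_comm y x, sub_sq_comm]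
      exact (hpt y x hy h).trans (by gcongr; exact le_add_self)
  have hsq : ∀ t : ℝ≥0∞, (t ^ (1 / 2 : ℝ)) ^ 2 = t := fun t => by
    rw [← ENNReal.rpow_natCast, ← ENNReal.rpow_mul]; norm_num
  simp_rw [hsq]
  have hae : ∀ᵐ x : ℝ, x ≠ 0 := Measure.ae_ne volume 0
  calc _ ≤ ∫⁻ x : ℝ, ∫⁻ y : ℝ, C * (G x y + G y x) := by
        refine lintegral_mono_ae ?_
        filter_upwards [hae] with x hx
        refine lintegral_mono_ae ?_
        filter_upwards [hae] with y hy
        exact hsum x hx y hy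
    _ = C * ((∫⁻ x : ℝ, ∫⁻ y : ℝ, G x y) + ∫⁻ x : ℝ, ∫⁻ y : ℝ, G y x) := by
        rw [← lintegral_add_left hGmeas.lintegral_prod_right,
          ← lintegral_const_mul' _ _ ENNReal.ofReal_ne_top]
        refine lintegral_congr fun x => ?_
        rw [lintegral_const_mul' _ _ ENNReal.ofReal_ne_top,
          lintegral_add_left (f := fun y => G x y) (hGmeas.comp measurable_prodMk_left)]
    _ < ⊤ := ENNReal.mul_lt_top ENNReal.ofReal_lt_top (ENNReal.add_lt_top.2 ⟨hG, hG'⟩)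
end
end

section
/- Let γ ∈ (0,1/2), 0 < ε < γ and set θ = γ − ε. There exists a constant C > 0 (depending on γ, ε and ϕ₀) such that for every η with 0 < |η| < 2/3, ∫_ℝ (|y|^{γ−1/2}ϕ₀(y) − |η|^{γ−1/2}ϕ₀(η))² / |y−η|^{1+2θ} dy ≤ C |η|^{2ε−1}. -/
open MeasureTheory Real Set
open scoped ENNReal

noncomputable section

theorem lintegral_eq_ofReal_abs_mul_lintegral_comp_mul_left (f : ℝ → ℝ≥0∞) {a : ℝ} (ha : a ≠ 0) :
    ∫⁻ y, f y = ENNReal.ofReal |a| * ∫⁻ u, f (a * u) := by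
  have hemb : MeasurableEmbedding (a * · : ℝ → ℝ) := (Homeomorph.mulLeft₀ a ha).measurableEmbedding
  conv_lhs => rw [← Real.smul_map_volume_mul_left ha]
  rw [lintegral_smul_measure, hemb.lintegral_map, smul_eq_mul]

theorem integrable_indicator_abs_rpow {s : ℝ} (hs : -1 < s) :
    Integrable ((Ioc (-1 : ℝ) 1).indicator fun u ↦ |u| ^ s) := by
  rw [integrable_indicator_iff measurableSet_Ioc,
    ← intervalIntegrable_iff_integrableOn_Ioc_of_le (by norm_num)]
  refine intervalIntegrable_of_even (by simp) fun x hx ↦ ?_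
  refine (intervalIntegral.intervalIntegrable_rpow' hs).congr fun y hy ↦ ?_
  rw [uIoc_of_le hx.le] at hy
  simp [abs_of_pos hy.1]

/-- For `a ∈ [0, 1]` the function `u ↦ u ^ (-a)` is Lipschitz near `1`, with a constant
independent of `a`. -/
theorem abs_rpow_neg_sub_one_le {a u : ℝ} (ha : 0 ≤ a) (ha1 : a ≤ 1) (hu : 1 / 2 ≤ u) :
    |u ^ (-a) - 1| ≤ 2 * |u - 1| := by
  have hu0 : 0 < u := by linarith
  have hinv : u⁻¹ ≤ 2 := by
    rw [inv_le_comm₀ hu0 (by norm_num)]; linarith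
  have hmul : u * u⁻¹ = 1 := mul_inv_cancel₀ hu0.ne'
  rcases le_total 1 u with h | h
  · have h1 : u ^ (-a) ≤ 1 := rpow_le_one_of_one_le_of_nonpos h (by linarith)
    have h2 : u⁻¹ ≤ u ^ (-a) := by
      rw [← rpow_neg_one]; exact rpow_le_rpow_of_exponent_le h (by linarith)
    rw [abs_of_nonpos (by linarith), abs_of_nonneg (by linarith)]
    nlinarith
  · have h1 : 1 ≤ u ^ (-a) := one_le_rpow_of_pos_of_le_one_of_nonpos hu0 h (by linarith)
    have h2 : u ^ (-a) ≤ u⁻¹ := by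
      rw [← rpow_neg_one]; exact rpow_le_rpow_of_exponent_ge hu0 h (by linarith)
    rw [abs_of_nonneg (by linarith), abs_of_nonpos (by linarith)]
    nlinarith

/-- Near `u = 1` the Stein quotient of `|u| ^ (-a)` is bounded. -/
theorem sq_rpow_sub_one_div_le_near {a p u : ℝ} (ha : 0 ≤ a) (ha1 : a ≤ 1)
    (hp : 0 ≤ p) (hp2 : p ≤ 2) (hu : |u - 1| ≤ 1 / 2) :
    (|u| ^ (-a) - 1) ^ 2 / |u - 1| ^ p ≤ 4 * 5 ^ p * (1 + |u|) ^ (-p) := by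
  have hu' := abs_le.1 hu
  have hu0 : 0 < u := by linarith
  rw [abs_of_pos hu0]
  have hA : (u ^ (-a) - 1) ^ 2 / |u - 1| ^ p ≤ 4 := by
    rcases eq_or_ne u 1 with rfl | hne
    · simp
    have hpos : 0 < |u - 1| := abs_pos.2 (sub_ne_zero.2 hne)
    rw [div_le_iff₀ (rpow_pos_of_pos hpos p)]
    have h1 := abs_rpow_neg_sub_one_le ha ha1 (show 1 / 2 ≤ u by linarith)
    have h2 : |u - 1| ^ 2 ≤ |u - 1| ^ p := by
      rw [← rpow_two]
      exact rpow_le_rpow_of_exponent_ge hpos (by linarith) hp2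
    rw [← sq_abs (u ^ (-a) - 1)]
    nlinarith [abs_nonneg (u ^ (-a) - 1)]
  have hB : 1 ≤ 5 ^ p * (1 + u) ^ (-p) := by
    rw [rpow_neg (by linarith), ← div_eq_mul_inv, one_le_div (by positivity)]
    exact rpow_le_rpow (by linarith) (by linarith) hp
  rw [mul_assoc]
  linarith

/-- Away from `u = 1` the Stein quotient is dominated by a decaying term plus a local singularity. -/
theorem sq_rpow_mul_sub_one_div_le_far {a p u v M : ℝ} (ha : 0 ≤ a) (hp : 0 ≤ p)
    (hv : |v| ≤ M) (hu : 1 / 2 < |u - 1|) :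
    (|u| ^ (-a) * v - 1) ^ 2 / |u - 1| ^ p ≤
      5 ^ p * ((2 * M ^ 2 + 2) * (1 + |u|) ^ (-p) +
        2 * M ^ 2 * (Ioc (-1 : ℝ) 1).indicator (fun u ↦ |u| ^ (-(2 * a))) u) := by
  set I := (Ioc (-1 : ℝ) 1).indicator (fun u ↦ |u| ^ (-(2 * a))) u with hI
  have hsq : (|u| ^ (-a)) ^ 2 = |u| ^ (-(2 * a)) := by
    rw [← rpow_two, ← rpow_mul (abs_nonneg u)]; ring_nf
  have hI0 : 0 ≤ I := indicator_nonneg (fun x _ ↦ by positivity) u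
  have hle : |u| ^ (-(2 * a)) ≤ I + 1 := by
    by_cases hmem : u ∈ Ioc (-1 : ℝ) 1
    · rw [hI, indicator_of_mem hmem]; linarith
    · have h1 : 1 ≤ |u| := by
        by_contra! hlt
        exact hmem (Ioo_subset_Ioc_self (abs_lt.1 hlt))
      have := rpow_le_one_of_one_le_of_nonpos h1 (show -(2 * a) ≤ 0 by linarith)
      linarith
  have hv2 : v ^ 2 ≤ M ^ 2 := by
    rw [← sq_abs v]; exact pow_le_pow_left₀ (abs_nonneg v) hv 2
  have hnum : (|u| ^ (-a) * v - 1) ^ 2 ≤ 2 * M ^ 2 * I + (2 * M ^ 2 + 2) := by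
    have h1 : (|u| ^ (-a) * v - 1) ^ 2 ≤ 2 * (|u| ^ (-(2 * a)) * v ^ 2) + 2 := by
      rw [← hsq]; nlinarith [sq_nonneg (|u| ^ (-a) * v + 1)]
    have h2 : |u| ^ (-(2 * a)) * v ^ 2 ≤ (I + 1) * M ^ 2 := by gcongr
    linarith
  have hden : (|u - 1| ^ p)⁻¹ ≤ 5 ^ p * (1 + |u|) ^ (-p) := by
    have hpos : 0 < 1 + |u| := by positivity
    rw [rpow_neg hpos.le, ← div_eq_mul_inv, ← div_rpow (by norm_num) hpos.le,
      ← inv_rpow (abs_nonneg _)]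
    refine rpow_le_rpow (by positivity) ?_ hp
    rw [inv_eq_one_div, div_le_div_iff₀ (by linarith) hpos]
    have : |u| ≤ |u - 1| + 1 := by
      simpa using abs_add_le (u - 1) 1
    linarith
  have hone : (1 + |u|) ^ (-p) ≤ 1 :=
    rpow_le_one_of_one_le_of_nonpos (by linarith [abs_nonneg u]) (by linarith)
  calc (|u| ^ (-a) * v - 1) ^ 2 / |u - 1| ^ p
      ≤ (2 * M ^ 2 * I + (2 * M ^ 2 + 2)) * (5 ^ p * (1 + |u|) ^ (-p)) := by
        rw [div_eq_mul_inv]; gcongr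
    _ = 5 ^ p * ((2 * M ^ 2 + 2) * (1 + |u|) ^ (-p) + 2 * M ^ 2 * I * (1 + |u|) ^ (-p)) := by ring
    _ ≤ 5 ^ p * ((2 * M ^ 2 + 2) * (1 + |u|) ^ (-p) + 2 * M ^ 2 * I) := by
        have : 2 * M ^ 2 * I * (1 + |u|) ^ (-p) ≤ 2 * M ^ 2 * I :=
          mul_le_of_le_one_right (by positivity) hone
        exact mul_le_mul_of_nonneg_left (by linarith) (by positivity)

/-- The small frequency estimate in the proof of Proposition 2.10: for 0 < |η| < 2/3, the
Stein integral of order θ = γ − ε of |ξ|^{γ−1/2}ϕ₀(ξ) is bounded by C|η|^{2ε−1}. -/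
theorem steinDeriv_rpow_cutoff_small_eta
    (γ ε : ℝ) (hγ : γ ∈ Ioo (0 : ℝ) (1 / 2)) (hε : 0 < ε) (hεγ : ε < γ)
    (ϕ₀ : ℝ → ℝ) (hϕ_smooth : ContDiff ℝ (⊤ : ℕ∞) ϕ₀)
    (hϕ_supp : tsupport ϕ₀ ⊆ Icc (-2 : ℝ) 2)
    (hϕ_one : ∀ x ∈ Ioo (-1 : ℝ) 1, ϕ₀ x = 1) :
    ∃ C : ℝ, 0 < C ∧ ∀ η : ℝ, 0 < |η| → |η| < 2 / 3 →
      ∫⁻ y : ℝ, ENNReal.ofReal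
          ((|y| ^ (γ - 1 / 2) * ϕ₀ y - |η| ^ (γ - 1 / 2) * ϕ₀ η) ^ 2 /
            |y - η| ^ (1 + 2 * (γ - ε))) ≤
        ENNReal.ofReal (C * |η| ^ (2 * ε - 1)) := by
  obtain ⟨hγ0, hγ1⟩ := hγ
  have hcpt : HasCompactSupport ϕ₀ := isCompact_Icc.of_isClosed_subset (isClosed_tsupport _) hϕ_supp
  obtain ⟨M, hM⟩ := hcpt.exists_bound_of_continuous hϕ_smooth.continuous
  obtain ⟨a, ha⟩ : ∃ a, a = 1 / 2 - γ := ⟨_, rfl⟩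
  obtain ⟨p, hp⟩ : ∃ p, p = 1 + 2 * (γ - ε) := ⟨_, rfl⟩
  rw [show γ - 1 / 2 = -a by linarith, ← hp]
  let G : ℝ → ℝ := fun u ↦ 5 ^ p * ((2 * M ^ 2 + 2) * (1 + |u|) ^ (-p) +
    2 * M ^ 2 * (Ioc (-1 : ℝ) 1).indicator (fun u ↦ |u| ^ (-(2 * a))) u) +
      4 * 5 ^ p * (1 + |u|) ^ (-p)
  have hdecay : Integrable fun u : ℝ ↦ (1 + |u|) ^ (-p) :=
    integrable_one_add_norm (by simp; linarith)
  have hG : Integrable G := (((hdecay.const_mul _).add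
    ((integrable_indicator_abs_rpow (by linarith)).const_mul _)).const_mul _).add
      (hdecay.const_mul _)
  have hI0 (u : ℝ) : 0 ≤ (Ioc (-1 : ℝ) 1).indicator (fun u ↦ |u| ^ (-(2 * a))) u :=
    indicator_nonneg (fun x _ ↦ by positivity) u
  have hG0 (u : ℝ) : 0 ≤ G u := by
    have := hI0 u
    positivity
  have hint : 0 ≤ ∫ u, G u := integral_nonneg hG0
  refine ⟨(∫ u, G u) + 1, by linarith, fun η hη hη' ↦ ?_⟩
  have hϕη : ϕ₀ η = 1 := hϕ_one η (abs_lt.1 (by linarith))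
  have hbound (u : ℝ) : (|u| ^ (-a) * ϕ₀ (η * u) - 1) ^ 2 / |u - 1| ^ p ≤ G u := by
    rcases le_or_gt |u - 1| (1 / 2) with hu | hu
    · have hu' := abs_le.1 hu
      have h1 : ϕ₀ (η * u) = 1 := by
        refine hϕ_one _ (abs_lt.1 ?_)
        rw [abs_mul, abs_of_pos (show 0 < u by linarith)]
        nlinarith
      rw [h1, mul_one]
      refine (sq_rpow_sub_one_div_le_near (by linarith) (by linarith) (by linarith)
        (by linarith) hu).trans (le_add_of_nonneg_left ?_)
      have := hI0 u
      positivity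
    · exact (sq_rpow_mul_sub_one_div_le_far (by linarith) (by linarith) (hM _) hu).trans
        (le_add_of_nonneg_right (by positivity))
  have hscale (u : ℝ) : (|η * u| ^ (-a) * ϕ₀ (η * u) - |η| ^ (-a) * ϕ₀ η) ^ 2 /
      |η * u - η| ^ p =
        |η| ^ (-(2 * a) - p) * ((|u| ^ (-a) * ϕ₀ (η * u) - 1) ^ 2 / |u - 1| ^ p) := by
    have hsq : |η| ^ (-(2 * a)) = (|η| ^ (-a)) ^ 2 := by
      rw [← rpow_two, ← rpow_mul hη.le]; ring_nf
    rw [hϕη, show η * u - η = η * (u - 1) by ring, abs_mul, abs_mul,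
      mul_rpow hη.le (abs_nonneg _), mul_rpow hη.le (abs_nonneg _), rpow_sub hη, hsq]
    rw [div_mul_div_comm]
    ring
  calc _ = ENNReal.ofReal |η| * ∫⁻ u, ENNReal.ofReal
        (|η| ^ (-(2 * a) - p) * ((|u| ^ (-a) * ϕ₀ (η * u) - 1) ^ 2 / |u - 1| ^ p)) := by
        rw [lintegral_eq_ofReal_abs_mul_lintegral_comp_mul_left _ (abs_pos.1 hη)]
        simp_rw [hscale]
    _ ≤ ENNReal.ofReal |η| * ∫⁻ u, ENNReal.ofReal (|η| ^ (-(2 * a) - p) * G u) := by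
        gcongr with u
        exact hbound u
    _ = ENNReal.ofReal (|η| * (|η| ^ (-(2 * a) - p) * ∫ u, G u)) := by
        rw [← ofReal_integral_eq_lintegral_ofReal (hG.const_mul _)
          (ae_of_all _ fun u ↦ mul_nonneg (by positivity) (hG0 u)),
          integral_const_mul, ENNReal.ofReal_mul hη.le]
    _ ≤ ENNReal.ofReal (((∫ u, G u) + 1) * |η| ^ (2 * ε - 1)) := by
        refine ENNReal.ofReal_le_ofReal ?_
        have hexp : |η| ^ (2 * ε - 1) = |η| * |η| ^ (-(2 * a) - p) := by
          rw [show 2 * ε - 1 = 1 + (-(2 * a) - p) by rw [ha, hp]; ring, rpow_add hη, rpow_one]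
        have hpos : 0 < |η| ^ (2 * ε - 1) := rpow_pos_of_pos hη _
        rw [← mul_assoc, ← hexp]
        linarith
end
end

section
/- Let γ ∈ (0,1/2), 0 < ε < γ and set θ = γ − ε. There exists a constant C > 0 (depending on γ, ε and ϕ₀) such that for every η with |η| > 200, ∫_ℝ (|y|^{γ−1/2}ϕ₀(y) − |η|^{γ−1/2}ϕ₀(η))² / |y−η|^{1+2θ} dy ≤ C (|η| − 2)^{−1−2θ}. -/
open MeasureTheory Real Set
open scoped ENNReal

noncomputable section

theorem integrableOn_abs_rpow_Icc {r : ℝ} (hr : -1 < r) (R : ℝ) :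
    IntegrableOn (fun y : ℝ => |y| ^ r) (Icc (-R) R) := by
  rcases lt_or_ge R 0 with hR | hR
  · rw [Icc_eq_empty (by linarith)]
    exact integrableOn_empty
  rw [← intervalIntegrable_iff_integrableOn_Icc_of_le (by linarith)]
  refine intervalIntegrable_of_even (by simp) fun x hx => ?_
  refine (intervalIntegral.intervalIntegrable_rpow' (a := 0) (b := x) hr).congr fun y hy => ?_
  rw [uIoc_of_le hx.le] at hy
  simp only [abs_of_pos hy.1]

/-- The large frequency estimate in the proof of Proposition 2.10: for |η| > 200, the
Stein integral of order θ = γ − ε of |ξ|^{γ−1/2}ϕ₀(ξ) is bounded by C(|η|−2)^{−1−2θ}. -/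
theorem steinDeriv_rpow_cutoff_large_eta
    (γ ε : ℝ) (hγ : γ ∈ Ioo (0 : ℝ) (1 / 2)) (hε : 0 < ε) (hεγ : ε < γ)
    (ϕ₀ : ℝ → ℝ) (hϕ_smooth : ContDiff ℝ (⊤ : ℕ∞) ϕ₀)
    (hϕ_supp : tsupport ϕ₀ ⊆ Icc (-2 : ℝ) 2)
    (hϕ_one : ∀ x ∈ Ioo (-1 : ℝ) 1, ϕ₀ x = 1) :
    ∃ C : ℝ, 0 < C ∧ ∀ η : ℝ, 200 < |η| →
      ∫⁻ y : ℝ, ENNReal.ofReal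
          ((|y| ^ (γ - 1 / 2) * ϕ₀ y - |η| ^ (γ - 1 / 2) * ϕ₀ η) ^ 2 /
            |y - η| ^ (1 + 2 * (γ - ε))) ≤
        ENNReal.ofReal (C * (|η| - 2) ^ (-(1 + 2 * (γ - ε)))) := by
  obtain ⟨hγ0, -⟩ := hγ
  have hzero : ∀ x, x ∉ Icc (-2 : ℝ) 2 → ϕ₀ x = 0 := fun x hx =>
    image_eq_zero_of_notMem_tsupport fun h => hx (hϕ_supp h)
  obtain ⟨M, hM⟩ := (isCompact_Icc (a := (-2 : ℝ)) (b := 2)).exists_bound_of_continuousOn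
    hϕ_smooth.continuous.continuousOn
  have hint := integrableOn_abs_rpow_Icc (r := 2 * γ - 1) (by linarith) 2
  set I := ∫ y in Icc (-2 : ℝ) 2, |y| ^ (2 * γ - 1) with hI
  have hI0 : 0 ≤ I := integral_nonneg fun y => by positivity
  refine ⟨M ^ 2 * I + 1, by positivity, fun η hη => ?_⟩
  set s := 1 + 2 * (γ - ε) with hs
  have hs0 : 0 < s := by linarith
  set K := (|η| - 2) ^ (-s) with hK
  have hK0 : 0 ≤ K := rpow_nonneg (by linarith) _
  have hη0 : ϕ₀ η = 0 := hzero η fun h => by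
    have := abs_le.2 h
    linarith
  have hbound : ∀ y, ENNReal.ofReal
      ((|y| ^ (γ - 1 / 2) * ϕ₀ y - |η| ^ (γ - 1 / 2) * ϕ₀ η) ^ 2 / |y - η| ^ s) ≤
      (Icc (-2 : ℝ) 2).indicator
        (fun y => ENNReal.ofReal (M ^ 2 * K * |y| ^ (2 * γ - 1))) y := by
    intro y
    by_cases hy : y ∈ Icc (-2 : ℝ) 2
    · rw [indicator_of_mem hy]
      refine ENNReal.ofReal_le_ofReal ?_
      have hdist : |η| - 2 ≤ |y - η| := by
        have h1 := abs_le.2 hy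
        have h2 := abs_sub_abs_le_abs_sub η y
        rw [abs_sub_comm] at h2
        linarith
      have hk : (|y - η| ^ s)⁻¹ ≤ K := by
        rw [hK, rpow_neg (by linarith)]
        exact inv_anti₀ (rpow_pos_of_pos (by linarith) _)
          (rpow_le_rpow (by linarith) hdist hs0.le)
      have hsq : (|y| ^ (γ - 1 / 2)) ^ 2 = |y| ^ (2 * γ - 1) := by
        rw [← rpow_mul_natCast (abs_nonneg y)]
        congr 1
        push_cast
        ring
      have hϕ : ϕ₀ y ^ 2 ≤ M ^ 2 := sq_le_sq' (abs_le.1 (hM y hy)).1 (abs_le.1 (hM y hy)).2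
      rw [hη0, mul_zero, sub_zero, mul_pow, hsq, div_eq_mul_inv]
      calc |y| ^ (2 * γ - 1) * ϕ₀ y ^ 2 * (|y - η| ^ s)⁻¹
          ≤ |y| ^ (2 * γ - 1) * M ^ 2 * K := by gcongr
        _ = M ^ 2 * K * |y| ^ (2 * γ - 1) := by ring
    · simp [hzero y hy, hη0]
  calc _ ≤ ∫⁻ y, (Icc (-2 : ℝ) 2).indicator
        (fun y => ENNReal.ofReal (M ^ 2 * K * |y| ^ (2 * γ - 1))) y := lintegral_mono hbound
    _ = ENNReal.ofReal (M ^ 2 * K * I) := by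
      rw [lintegral_indicator measurableSet_Icc, ← ofReal_integral_eq_lintegral_ofReal
        (hint.const_mul _) (Filter.Eventually.of_forall fun y => by positivity),
        integral_const_mul]
    _ ≤ _ := ENNReal.ofReal_le_ofReal (by linarith)
end
end

section
/- Let a ∈ (0,1), θ ∈ (0,1), σ₁ ∈ {0,1}, σ₂ ≥ 1 a real number and σ₃ a nonnegative integer. For every t ≥ 0 there exists a constant C = C(t,a,θ,σ₁,σ₂,σ₃) such that for all f : ℝ² → ℂ with the right-hand side finite, ‖𝒟^θ_ξ(χ(ξ,η) ψ(ξ,η,t) sgn(ξ)^{σ₁} |ξ|^{σ₂} η^{σ₃} f̂)‖_{L²(ℝ²)} ≤ C(‖f‖ + ‖|x|^θ f‖). -/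
open MeasureTheory Real Set
open scoped ENNReal

noncomputable section

/-- Fourier transform on ℝ². -/
def FT (f : ℝ × ℝ → ℂ) : ℝ × ℝ → ℂ := fun ζ =>
  ∫ p : ℝ × ℝ, Complex.exp (-(Complex.I * ((p.1 * ζ.1 + p.2 * ζ.2 : ℝ) : ℂ))) * f p

/-- Inverse Fourier transform on ℝ². -/
def invFT (g : ℝ × ℝ → ℂ) : ℝ × ℝ → ℂ := fun p =>
  ((((2 * Real.pi) ^ 2 : ℝ)⁻¹ : ℝ) : ℂ) *
    ∫ ζ : ℝ × ℝ, Complex.exp (Complex.I * ((p.1 * ζ.1 + p.2 * ζ.2 : ℝ) : ℂ)) * g ζ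

/-- Fourier multiplier operator with symbol `m`. -/
def fourierMult (m : ℝ × ℝ → ℂ) (f : ℝ × ℝ → ℂ) : ℝ × ℝ → ℂ :=
  invFT fun ζ => m ζ * FT f ζ

/-- Bessel operator in the x-direction, symbol (1+ξ²)^{s/2}. -/
def Jx (s : ℝ) : (ℝ × ℝ → ℂ) → ℝ × ℝ → ℂ :=
  fourierMult fun ζ => (((1 + ζ.1 ^ 2) ^ (s / 2) : ℝ) : ℂ)

/-- Riesz operator in the x-direction, symbol |ξ|^s. -/
def Dx (s : ℝ) : (ℝ × ℝ → ℂ) → ℝ × ℝ → ℂ :=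
  fourierMult fun ζ => ((|ζ.1| ^ s : ℝ) : ℂ)

/-- Riesz operator in the y-direction, symbol |η|^s. -/
def Dy (s : ℝ) : (ℝ × ℝ → ℂ) → ℝ × ℝ → ℂ :=
  fourierMult fun ζ => ((|ζ.2| ^ s : ℝ) : ℂ)

/-- The symbol ψ(ξ,η,t) = exp(i t ξ(η² − |ξ|^{1+a})) of the linear gBO-ZK group. -/
def psi (a t : ℝ) (ζ : ℝ × ℝ) : ℂ :=
  Complex.exp (Complex.I * ((t * ζ.1 * (ζ.2 ^ 2 - |ζ.1| ^ (1 + a)) : ℝ) : ℂ))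

/-- Stein derivative of order b in the first (ξ) variable of g : ℝ² → ℂ. -/
def steinDxi (b : ℝ) (g : ℝ × ℝ → ℂ) (p : ℝ × ℝ) : ℝ≥0∞ :=
  (∫⁻ y : ℝ, ENNReal.ofReal (‖g p - g (y, p.2)‖ ^ 2 / |p.1 - y| ^ (1 + 2 * b))) ^ (1 / 2 : ℝ)

/-- The L²(ℝ²) norm of the Stein derivative 𝒟^b_ξ g. -/
def steinL2norm (b : ℝ) (g : ℝ × ℝ → ℂ) : ℝ≥0∞ :=
  (∫⁻ p : ℝ × ℝ, steinDxi b g p ^ 2) ^ (1 / 2 : ℝ)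

open scoped FourierTransform SchwartzMap in
theorem eLpNorm_fourier_eq {V : Type*} [NormedAddCommGroup V] [InnerProductSpace ℝ V]
    [FiniteDimensional ℝ V] [MeasurableSpace V] [BorelSpace V] {f : V → ℂ}
    (hf : Integrable f) (hf2 : MemLp f 2) :
    eLpNorm (𝓕 f) 2 = eLpNorm f 2 := by
  have hcont : Continuous (𝓕 f) :=
    VectorFourier.fourierIntegral_continuous Real.continuous_fourierChar
      (by exact continuous_inner) hf
  have hae : (𝓕 (hf2.toLp f) : Lp ℂ 2 (volume : Measure V)) =ᵐ[volume] 𝓕 f := by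
    refine ae_eq_of_integral_contDiff_smul_eq
      ((Lp.memLp _).locallyIntegrable (by norm_num)) hcont.locallyIntegrable fun g hg hgc => ?_
    have hc : HasCompactSupport (fun x => (g x : ℂ)) := hgc.comp_left (g := fun r : ℝ => (r : ℂ)) rfl
    let φ : 𝓢(V, ℂ) := hc.toSchwartzMap
      (Complex.ofRealCLM.contDiff.comp hg)
    have hφ : ∀ x, φ x = (g x : ℂ) := fun x => rfl
    have h1 := congrArg (fun T : 𝓢'(V, ℂ) => T φ)
      (Lp.fourier_toTemperedDistribution_eq (hf2.toLp f))
    simp only [TemperedDistribution.fourier_apply, Lp.toTemperedDistribution_apply] at h1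
    have h2 : ∫ x, (𝓕 φ) x • (hf2.toLp f) x = ∫ x, (𝓕 φ) x • f x := by
      refine integral_congr_ae ?_
      filter_upwards [hf2.coeFn_toLp] with x hx
      rw [hx]
    have h3 : ∫ x, (𝓕 (φ : V → ℂ)) x • f x = ∫ x, φ x • 𝓕 f x :=
      VectorFourier.integral_fourierIntegral_smul_eq_flip (L := innerₗ V)
        Real.continuous_fourierChar (by exact continuous_inner) φ.integrable hf |>.trans (by
          rw [flip_innerₗ]; rfl)
    rw [h2, SchwartzMap.fourier_coe, h3] at h1
    simpa [hφ] using h1.symm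
  rw [← eLpNorm_congr_ae hae, ← Lp.enorm_def, ← eLpNorm_congr_ae hf2.coeFn_toLp, ← Lp.enorm_def,
    ← ofReal_norm, ← ofReal_norm, Lp.norm_fourier_eq]

theorem integrable_exp_mul_iff (f : ℝ × ℝ → ℂ) (ζ : ℝ × ℝ) :
    Integrable (fun p : ℝ × ℝ =>
      Complex.exp (-(Complex.I * ((p.1 * ζ.1 + p.2 * ζ.2 : ℝ) : ℂ))) * f p) ↔ Integrable f := by
  have key : ∀ (s : ℝ) (g : ℝ × ℝ → ℂ), Integrable g → Integrable (fun p : ℝ × ℝ =>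
      Complex.exp (Complex.I * ((s * (p.1 * ζ.1 + p.2 * ζ.2) : ℝ) : ℂ)) * g p) := by
    intro s g hg
    refine hg.bdd_mul (c := 1) (by fun_prop) (.of_forall fun p => ?_)
    rw [Complex.norm_exp_I_mul_ofReal]
  refine ⟨fun h => ?_, fun h => ?_⟩
  · refine (key 1 _ h).congr (.of_forall fun p => ?_)
    simp only [← mul_assoc, ← Complex.exp_add]
    simp
  · refine (key (-1) _ h).congr (.of_forall fun p => ?_)
    simp only [neg_one_mul, Complex.ofReal_neg, mul_neg]

theorem FT_eq_zero_of_not_integrable {f : ℝ × ℝ → ℂ} (hf : ¬ Integrable f) : FT f = 0 := by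
  ext ζ
  exact integral_undef fun h => hf ((integrable_exp_mul_iff f ζ).1 h)

theorem continuous_FT {f : ℝ × ℝ → ℂ} (hf : Integrable f) : Continuous (FT f) := by
  refine continuous_of_dominated (bound := fun p => ‖f p‖)
    (fun ζ => ((integrable_exp_mul_iff f ζ).2 hf).aestronglyMeasurable)
    (fun ζ => .of_forall fun p => ?_) hf.norm (.of_forall fun p => by fun_prop)
  rw [norm_mul, ← mul_neg, ← Complex.ofReal_neg, Complex.norm_exp_I_mul_ofReal, one_mul]

open scoped FourierTransform in
theorem FT_eq_fourier (f : ℝ × ℝ → ℂ) (ζ : ℝ × ℝ) :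
    FT f ζ = 𝓕 (fun v : WithLp 2 (ℝ × ℝ) => f v.ofLp) (WithLp.toLp 2 ((2 * π)⁻¹ • ζ)) := by
  rw [Real.fourier_eq', ← (WithLp.volume_preserving_toLp ℝ ℝ).integral_comp
    (MeasurableEquiv.toLp 2 (ℝ × ℝ)).measurableEmbedding]
  refine integral_congr_ae (.of_forall fun p => ?_)
  have hp : (π : ℂ) ≠ 0 := by exact_mod_cast pi_ne_zero
  simp only [smul_eq_mul, WithLp.prod_inner_apply]
  congr 2
  simp
  field_simp

theorem eLpNorm_sq_eq_lintegral {α : Type*} [MeasurableSpace α] (μ : Measure α) (f : α → ℂ) :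
    eLpNorm f 2 μ ^ 2 = ∫⁻ x, ‖f x‖ₑ ^ 2 ∂μ := by
  have := eLpNorm_nnreal_pow_eq_lintegral (μ := μ) (f := f) (p := 2) (by norm_num)
  simpa using this

theorem lintegral_FT_sq {f : ℝ × ℝ → ℂ} (hf : Integrable f) (hf2 : MemLp f 2) :
    ∫⁻ ζ, ‖FT f ζ‖ₑ ^ 2 = ENNReal.ofReal ((2 * π) ^ 2) * ∫⁻ p, ‖f p‖ₑ ^ 2 := by
  have hmp := WithLp.volume_preserving_ofLp ℝ ℝ
  have hmp' := WithLp.volume_preserving_toLp ℝ ℝ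
  have he : MeasurableEmbedding (WithLp.toLp 2 : ℝ × ℝ → _) :=
    (MeasurableEquiv.toLp 2 (ℝ × ℝ)).measurableEmbedding
  have h := eLpNorm_fourier_eq (f := fun v : WithLp 2 (ℝ × ℝ) => f v.ofLp)
    (hmp.integrable_comp_of_integrable hf) (hf2.comp_measurePreserving hmp)
  have h' := congrArg (· ^ 2) h
  simp only [eLpNorm_sq_eq_lintegral] at h'
  rw [← hmp'.lintegral_comp_emb he, ← hmp'.lintegral_comp_emb he] at h'
  rw [← h']
  simp_rw [FT_eq_fourier]
  have hpos : (2 * π)⁻¹ ≠ 0 := by positivity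
  have hs := Measure.map_addHaar_smul (volume : Measure (ℝ × ℝ)) hpos
  have hm := (Homeomorph.smulOfNeZero (α := ℝ × ℝ) _ hpos).measurableEmbedding
  have := hm.lintegral_map (μ := volume)
    (fun ζ => ‖FourierTransform.fourier (fun v : WithLp 2 (ℝ × ℝ) => f v.ofLp)
      (WithLp.toLp 2 ζ)‖ₑ ^ 2)
  rw [show (⇑(Homeomorph.smulOfNeZero (α := ℝ × ℝ) _ hpos)) = ((2 * π)⁻¹ • ·) from rfl, hs,
    lintegral_smul_measure] at this
  rw [← this, smul_eq_mul]
  congr 2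
  simp [abs_of_pos pi_pos, -mul_inv_rev]

/-- `f` is bounded by `C` and Lipschitz with constant `C`. -/
def IsBddLipschitz {E : Type*} [NormedRing E] (C : ℝ) (f : ℝ → E) : Prop :=
  (∀ x, ‖f x‖ ≤ C) ∧ ∀ x y, ‖f x - f y‖ ≤ C * |x - y|

namespace IsBddLipschitz

variable {E : Type*} [NormedRing E] {C D : ℝ} {f g : ℝ → E}

theorem nonneg (hf : IsBddLipschitz C f) : 0 ≤ C := (norm_nonneg _).trans (hf.1 0)

theorem const {c : E} (h : ‖c‖ ≤ C) : IsBddLipschitz C fun _ => c :=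
  ⟨fun _ => h, fun x y => by
    simpa using mul_nonneg ((norm_nonneg c).trans h) (abs_nonneg (x - y))⟩

theorem add (hf : IsBddLipschitz C f) (hg : IsBddLipschitz D g) :
    IsBddLipschitz (C + D) fun x => f x + g x :=
  ⟨fun x => norm_add_le_of_le (hf.1 x) (hg.1 x), fun x y => by
    rw [add_sub_add_comm, add_mul]
    exact norm_add_le_of_le (hf.2 x y) (hg.2 x y)⟩

theorem neg (hf : IsBddLipschitz C f) : IsBddLipschitz C fun x => -f x :=
  ⟨fun x => by rw [norm_neg]; exact hf.1 x, fun x y => by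
    rw [← neg_sub', norm_neg]; exact hf.2 x y⟩

theorem sub (hf : IsBddLipschitz C f) (hg : IsBddLipschitz D g) :
    IsBddLipschitz (C + D) fun x => f x - g x := by
  simpa only [sub_eq_add_neg] using hf.add hg.neg

theorem mul (hf : IsBddLipschitz C f) (hg : IsBddLipschitz D g) :
    IsBddLipschitz (2 * (C * D)) fun x => f x * g x := by
  have hC := hf.nonneg
  have hD := hg.nonneg
  refine ⟨fun x => ?_, fun x y => ?_⟩
  · refine (norm_mul_le_of_le (hf.1 x) (hg.1 x)).trans ?_
    nlinarith [mul_nonneg hC hD]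
  · rw [show f x * g x - f y * g y = f x * (g x - g y) + (f x - f y) * g y by noncomm_ring]
    refine (norm_add_le_of_le (norm_mul_le_of_le (hf.1 x) (hg.2 x y))
      (norm_mul_le_of_le (hf.2 x y) (hg.1 y))).trans (le_of_eq ?_)
    ring

theorem comp_neg (hf : IsBddLipschitz C f) : IsBddLipschitz C fun x => f (-x) :=
  ⟨fun x => hf.1 _, fun x y => (hf.2 _ _).trans (le_of_eq (by
    rw [← neg_sub', abs_neg]))⟩

theorem ofReal {f : ℝ → ℝ} (hf : IsBddLipschitz C f) : IsBddLipschitz C fun x => (f x : ℂ) :=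
  ⟨fun x => by rw [Complex.norm_real]; exact hf.1 x, fun x y => by
    rw [← Complex.ofReal_sub, Complex.norm_real]; exact hf.2 x y⟩

theorem cexp_I_mul {f : ℝ → ℝ} (hf : IsBddLipschitz C f) :
    IsBddLipschitz (C + 1) fun x => Complex.exp (Complex.I * (f x : ℂ)) := by
  refine ⟨fun x => ?_, fun x y => ?_⟩
  · rw [Complex.norm_exp_I_mul_ofReal]
    linarith [hf.nonneg]
  · have : Complex.exp (Complex.I * (f x : ℂ)) - Complex.exp (Complex.I * (f y : ℂ)) =
        Complex.exp (Complex.I * (f y : ℂ)) *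
          (Complex.exp (Complex.I * ((f x - f y : ℝ) : ℂ)) - 1) := by
      rw [mul_sub, ← Complex.exp_add, mul_one]
      congr 2
      push_cast
      ring
    rw [this, norm_mul, Complex.norm_exp_I_mul_ofReal, one_mul]
    refine (Real.norm_exp_I_mul_ofReal_sub_one_le).trans ((hf.2 x y).trans ?_)
    nlinarith [abs_nonneg (x - y)]

end IsBddLipschitz

/-- The power `x ↦ x ^ s`, precomposed with the projection onto `[0, 2]`. -/
def clampRpow (s x : ℝ) : ℝ := (max 0 (min 2 x)) ^ s

theorem clampRpow_isBddLipschitz {s : ℝ} (hs : 1 ≤ s) :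
    IsBddLipschitz ((1 + s) * 2 ^ s) (clampRpow s) := by
  have h0 : ∀ x : ℝ, max 0 (min 2 x) ∈ Icc (0 : ℝ) 2 := fun x =>
    ⟨le_max_left _ _, max_le (by norm_num) (min_le_left _ _)⟩
  have h2 : (0 : ℝ) < 2 ^ s := by positivity
  refine ⟨fun x => ?_, fun x y => ?_⟩
  · rw [clampRpow, Real.norm_of_nonneg (Real.rpow_nonneg (h0 x).1 _)]
    refine (Real.rpow_le_rpow (h0 x).1 (h0 x).2 (by linarith)).trans ?_
    nlinarith
  · have hd : ∀ z ∈ Icc (0 : ℝ) 2,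
        HasDerivWithinAt (fun u : ℝ => u ^ s) (s * z ^ (s - 1)) (Icc 0 2) z := fun z _ =>
      (Real.hasDerivAt_rpow_const (Or.inr hs)).hasDerivWithinAt
    have hb : ∀ z ∈ Icc (0 : ℝ) 2, ‖s * z ^ (s - 1)‖ ≤ (1 + s) * 2 ^ s := by
      intro z hz
      rw [Real.norm_of_nonneg (mul_nonneg (by linarith) (Real.rpow_nonneg hz.1 _))]
      have h1 : z ^ (s - 1) ≤ 2 ^ (s - 1) := Real.rpow_le_rpow hz.1 hz.2 (by linarith)
      have h3 : (2 : ℝ) ^ (s - 1) ≤ 2 ^ s :=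
        Real.rpow_le_rpow_of_exponent_le (by norm_num) (by linarith)
      nlinarith
    refine ((convex_Icc (0 : ℝ) 2).norm_image_sub_le_of_norm_hasDerivWithin_le hd hb
      (h0 y) (h0 x)).trans ?_
    gcongr
    refine (abs_max_sub_max_le_max _ _ _ _).trans (max_le (by simp) ?_)
    exact (abs_min_sub_min_le_max _ _ _ _).trans (max_le (by simp) le_rfl)

theorem abs_rpow_eq_clampRpow_add {s x : ℝ} (hs : 1 ≤ s) (hx : x ∈ Icc (-2 : ℝ) 2) :
    |x| ^ s = clampRpow s x + clampRpow s (-x) := by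
  have hs0 : s ≠ 0 := by linarith
  rw [clampRpow, clampRpow, min_eq_right hx.2, min_eq_right (by linarith [hx.1])]
  rcases le_total 0 x with h | h
  · rw [max_eq_right h, max_eq_left (by linarith), abs_of_nonneg h, Real.zero_rpow hs0, add_zero]
  · rw [max_eq_left h, max_eq_right (by linarith), abs_of_nonpos h, Real.zero_rpow hs0, zero_add]

theorem sign_mul_abs_rpow_eq_clampRpow_sub {s x : ℝ} (hs : 1 ≤ s) (hx : x ∈ Icc (-2 : ℝ) 2) :
    Real.sign x * |x| ^ s = clampRpow s x - clampRpow s (-x) := by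
  have hs0 : s ≠ 0 := by linarith
  rw [clampRpow, clampRpow, min_eq_right hx.2, min_eq_right (by linarith [hx.1])]
  rcases lt_trichotomy 0 x with h | h | h
  · rw [max_eq_right h.le, max_eq_left (by linarith), abs_of_pos h, Real.zero_rpow hs0,
      Real.sign_of_pos h]
    ring
  · simp [← h]
  · rw [max_eq_left h.le, max_eq_right (by linarith), abs_of_neg h, Real.zero_rpow hs0,
      Real.sign_of_neg h]
    ring

theorem exists_isBddLipschitz_eq_sign_pow_mul {s : ℝ} (hs : 1 ≤ s) {n : ℕ} (hn : n = 0 ∨ n = 1) :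
    ∃ (C : ℝ) (k : ℝ → ℝ), IsBddLipschitz C k ∧
      ∀ x ∈ Icc (-2 : ℝ) 2, Real.sign x ^ n * |x| ^ s = k x := by
  have h := clampRpow_isBddLipschitz hs
  rcases hn with rfl | rfl
  · exact ⟨_, _, h.add h.comp_neg, fun x hx => by
      rw [pow_zero, one_mul]; exact abs_rpow_eq_clampRpow_add hs hx⟩
  · exact ⟨_, _, h.sub h.comp_neg, fun x hx => by
      rw [pow_one]; exact sign_mul_abs_rpow_eq_clampRpow_sub hs hx⟩

theorem exists_isBddLipschitz_of_hasCompactSupport {φ : ℝ → ℝ} (hφ : ContDiff ℝ (⊤ : ℕ∞) φ)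
    (hc : HasCompactSupport φ) : ∃ C, IsBddLipschitz C φ := by
  obtain ⟨B, hB⟩ := hc.exists_bound_of_continuous hφ.continuous
  obtain ⟨L, hL⟩ := hφ.lipschitzWith_of_hasCompactSupport hc (by simp)
  refine ⟨max B L, fun x => (hB x).trans (le_max_left _ _), fun x y => ?_⟩
  refine (hL.norm_sub_le x y).trans ?_
  rw [Real.norm_eq_abs]
  gcongr
  exact le_max_right _ _

theorem exists_isBddLipschitz_symbol {a s t : ℝ} (ha : 0 < a) (hs : 1 ≤ s) {n : ℕ}
    (hn : n = 0 ∨ n = 1) (k : ℕ) {φ : ℝ → ℝ} (hφ : ContDiff ℝ (⊤ : ℕ∞) φ)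
    (hsupp : tsupport φ ⊆ Icc (-2 : ℝ) 2) :
    ∃ C : ℝ, ∀ η : ℝ, IsBddLipschitz C fun ξ =>
      ((φ ξ * φ η * Real.sign ξ ^ n * |ξ| ^ s * η ^ k : ℝ) : ℂ) * psi a t (ξ, η) := by
  have hc : HasCompactSupport φ := isCompact_Icc.of_isClosed_subset (isClosed_tsupport _) hsupp
  have hz : ∀ x ∉ Icc (-2 : ℝ) 2, φ x = 0 := fun x hx =>
    image_eq_zero_of_notMem_tsupport fun h => hx (hsupp h)
  obtain ⟨A, hA⟩ := exists_isBddLipschitz_of_hasCompactSupport hφ hc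
  obtain ⟨B, κ, hκ, hκe⟩ := exists_isBddLipschitz_eq_sign_pow_mul hs hn
  obtain ⟨D, q, hq, hqe⟩ := exists_isBddLipschitz_eq_sign_pow_mul
    (s := 1 + a) (by linarith) (n := 0) (Or.inl rfl)
  obtain ⟨F, c, hcl, hce⟩ := exists_isBddLipschitz_eq_sign_pow_mul
    (s := 1) le_rfl (n := 1) (Or.inr rfl)
  have hce' : ∀ x ∈ Icc (-2 : ℝ) 2, c x = x := fun x hx => by
    rw [← hce x hx, pow_one, Real.rpow_one]
    rcases lt_trichotomy 0 x with h | h | h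
    · rw [Real.sign_of_pos h, abs_of_pos h, one_mul]
    · simp [← h]
    · rw [Real.sign_of_neg h, abs_of_neg h]; ring
  have hamp := hA.mul hκ
  refine ⟨2 * (2 * (2 * (A * B) * (A * 2 ^ k)) * (2 * (2 * (‖t‖ * F) * (4 + D)) + 1)),
    fun η => ?_⟩
  by_cases hη : η ∈ Icc (-2 : ℝ) 2
  · have hη2 : ‖η ^ 2‖ ≤ 4 := by
      rw [Real.norm_of_nonneg (by positivity)]
      nlinarith [hη.1, hη.2]
    have hηk : ‖φ η * η ^ k‖ ≤ A * 2 ^ k := by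
      rw [norm_mul, norm_pow]
      refine mul_le_mul (hA.1 η) ?_ (by positivity) hA.nonneg
      gcongr
      exact abs_le.2 hη
    have hph := (((IsBddLipschitz.const (le_refl ‖t‖)).mul hcl).mul
      ((IsBddLipschitz.const hη2).sub hq)).cexp_I_mul
    have htot := ((hamp.mul (IsBddLipschitz.const hηk)).ofReal).mul hph
    convert! htot using 2 with ξ
    by_cases hξ : ξ ∈ Icc (-2 : ℝ) 2
    · simp only [psi]
      rw [← hκe ξ hξ, hce' ξ hξ, ← hqe ξ hξ, pow_zero, one_mul]
      congr 2
      ring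
    · simp [hz ξ hξ]
  · simp only [hz η hη, mul_zero, zero_mul, Complex.ofReal_zero]
    refine IsBddLipschitz.const ?_
    rw [norm_zero]
    have := hA.nonneg
    have := hκ.nonneg
    have := hq.nonneg
    have := hcl.nonneg
    positivity

/-- The truncated quadratic kernel controlling the Stein derivative of bounded Lipschitz
functions. -/
def steinKernel (θ x h : ℝ) : ℝ := min |h * x| 2 ^ 2 / |h| ^ (1 + 2 * θ)

theorem measurable_steinKernel (θ : ℝ) : Measurable fun q : ℝ × ℝ => steinKernel θ q.1 q.2 := by
  unfold steinKernel
  fun_prop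

theorem lintegral_steinKernel_one_lt_top {θ : ℝ} (hθ : θ ∈ Ioo (0 : ℝ) 1) :
    ∫⁻ h, ENNReal.ofReal (steinKernel θ 1 h) < ⊤ := by
  have hpos : ∫⁻ h in Ioi (0 : ℝ), ENNReal.ofReal (steinKernel θ 1 h) < ⊤ := by
    rw [← Ioc_union_Ioi_eq_Ioi (zero_le_one' ℝ)]
    refine (lintegral_union_le _ _ _).trans_lt (ENNReal.add_lt_top.2 ⟨?_, ?_⟩)
    · have hi : IntegrableOn (fun h : ℝ => h ^ (1 - 2 * θ)) (Ioc 0 1) :=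
        (intervalIntegrable_iff_integrableOn_Ioc_of_le zero_le_one).1
          (intervalIntegral.intervalIntegrable_rpow' (by linarith [hθ.2]))
      refine lt_of_le_of_lt (setLIntegral_mono' measurableSet_Ioc fun h hh => ?_)
        hi.lintegral_lt_top
      refine ENNReal.ofReal_le_ofReal ?_
      rw [steinKernel, mul_one, abs_of_pos hh.1, div_le_iff₀ (Real.rpow_pos_of_pos hh.1 _),
        ← Real.rpow_add hh.1, show 1 - 2 * θ + (1 + 2 * θ) = (2 : ℕ) by norm_num,
        Real.rpow_natCast]
      have := hh.1
      gcongr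
      exact min_le_left _ _
    · have hi : IntegrableOn (fun h : ℝ => 4 * h ^ (-(1 + 2 * θ))) (Ioi 1) :=
        (integrableOn_Ioi_rpow_of_lt (by linarith [hθ.1]) one_pos).const_mul 4
      refine lt_of_le_of_lt (setLIntegral_mono' measurableSet_Ioi fun h hh => ?_)
        hi.lintegral_lt_top
      refine ENNReal.ofReal_le_ofReal ?_
      have h0 : (0 : ℝ) < h := one_pos.trans hh
      rw [steinKernel, mul_one, abs_of_pos h0, Real.rpow_neg h0.le, div_eq_mul_inv]
      gcongr
      refine (pow_le_pow_left₀ (by positivity) (min_le_right _ _) 2).trans (by norm_num)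
  have hneg : ∫⁻ h in Iic (0 : ℝ), ENNReal.ofReal (steinKernel θ 1 h) < ⊤ := by
    rw [← setLIntegral_congr Iio_ae_eq_Iic, ← lintegral_indicator measurableSet_Iio,
      ← lintegral_neg_eq_self]
    rw [← lintegral_indicator measurableSet_Ioi] at hpos
    convert! hpos using 3 with h
    simp only [indicator, steinKernel, neg_mul, abs_neg, mem_Iio, mem_Ioi, Left.neg_neg_iff]
  rw [← setLIntegral_univ, ← Iic_union_Ioi (a := (0 : ℝ))]
  exact (lintegral_union_le _ _ _).trans_lt (ENNReal.add_lt_top.2 ⟨hneg, hpos⟩)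

theorem lintegral_steinKernel_le (θ x : ℝ) :
    ∫⁻ h, ENNReal.ofReal (steinKernel θ x h) ≤
      ENNReal.ofReal (|x| ^ (2 * θ)) * ∫⁻ h, ENNReal.ofReal (steinKernel θ 1 h) := by
  rcases eq_or_ne x 0 with rfl | hx
  · simp [steinKernel]
  have hx' : 0 < |x| := abs_pos.2 hx
  have hs : ∀ h, ENNReal.ofReal (steinKernel θ x h) =
      ENNReal.ofReal (|x| ^ (1 + 2 * θ)) * ENNReal.ofReal (steinKernel θ 1 (x * h)) := by
    intro h
    rw [← ENNReal.ofReal_mul (by positivity), steinKernel, steinKernel, mul_one, abs_mul x h,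
      Real.mul_rpow (abs_nonneg _) (abs_nonneg _), abs_mul, mul_comm |h|]
    congr 1
    have := (Real.rpow_pos_of_pos hx' (1 + 2 * θ)).ne'
    field_simp
  have hm : Measurable fun h => ENNReal.ofReal (steinKernel θ 1 h) :=
    ((measurable_steinKernel θ).comp (measurable_const.prodMk measurable_id)).ennreal_ofReal
  simp_rw [hs]
  rw [lintegral_const_mul' _ _ ENNReal.ofReal_ne_top,
    ← lintegral_map hm (measurable_const_mul x), Real.map_volume_mul_left hx,
    lintegral_smul_measure, smul_eq_mul, ← mul_assoc, ← ENNReal.ofReal_mul (by positivity), abs_inv]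
  refine le_of_eq ?_
  congr 2
  rw [add_comm, Real.rpow_add_one hx'.ne']
  field_simp

theorem norm_exp_sub_one_le_min (u : ℝ) :
    ‖Complex.exp (-(Complex.I * (u : ℂ))) - 1‖ ≤ min |u| 2 := by
  rw [← mul_neg, ← Complex.ofReal_neg]
  refine le_min ?_ ?_
  · simpa using Real.norm_exp_I_mul_ofReal_sub_one_le (x := -u)
  · refine (norm_sub_le _ _).trans ?_
    rw [Complex.norm_exp_I_mul_ofReal, norm_one]
    norm_num

theorem FT_sub_translate {f : ℝ × ℝ → ℂ} (hf : Integrable f) (h : ℝ) (ζ : ℝ × ℝ) :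
    FT f ζ - FT f (ζ.1 + h, ζ.2) =
      -FT (fun p => (Complex.exp (-(Complex.I * ((h * p.1 : ℝ) : ℂ))) - 1) * f p) ζ := by
  rw [FT, FT, FT, ← integral_sub ((integrable_exp_mul_iff f ζ).2 hf)
    ((integrable_exp_mul_iff f _).2 hf), ← integral_neg]
  refine integral_congr_ae (.of_forall fun p => ?_)
  have : Complex.exp (-(Complex.I * ((p.1 * (ζ.1 + h) + p.2 * ζ.2 : ℝ) : ℂ))) =
      Complex.exp (-(Complex.I * ((p.1 * ζ.1 + p.2 * ζ.2 : ℝ) : ℂ))) *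
        Complex.exp (-(Complex.I * ((h * p.1 : ℝ) : ℂ))) := by
    rw [← Complex.exp_add]
    congr 1
    push_cast
    ring
  simp only [this]
  ring

theorem lintegral_FT_sub_translate_le {f : ℝ × ℝ → ℂ} (hf : Integrable f) (hf2 : MemLp f 2)
    (h : ℝ) :
    ∫⁻ ζ, ‖FT f ζ - FT f (ζ.1 + h, ζ.2)‖ₑ ^ 2 ≤
      ENNReal.ofReal ((2 * π) ^ 2) *
        ∫⁻ p : ℝ × ℝ, ENNReal.ofReal (min |h * p.1| 2 ^ 2) * ‖f p‖ₑ ^ 2 := by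
  have hm : AEStronglyMeasurable (fun p : ℝ × ℝ =>
      Complex.exp (-(Complex.I * ((h * p.1 : ℝ) : ℂ))) - 1) :=
    Continuous.aestronglyMeasurable (by fun_prop)
  have hb : ∀ p : ℝ × ℝ, ‖Complex.exp (-(Complex.I * ((h * p.1 : ℝ) : ℂ))) - 1‖ ≤ 2 := fun p =>
    (norm_exp_sub_one_le_min _).trans (min_le_right _ _)
  simp_rw [FT_sub_translate hf h, enorm_neg]
  have hmem : MemLp (fun p : ℝ × ℝ =>
      (Complex.exp (-(Complex.I * ((h * p.1 : ℝ) : ℂ))) - 1) * f p) 2 :=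
    (hf2.const_mul (2 : ℂ)).mono (hm.mul hf2.1) (.of_forall fun p => by
      rw [norm_mul, norm_mul]
      gcongr
      simpa using hb p)
  rw [lintegral_FT_sq (hf.bdd_mul hm (.of_forall hb)) hmem]
  gcongr with p
  rw [enorm_mul, mul_pow]
  gcongr
  rw [← ofReal_norm, ← ENNReal.ofReal_pow (norm_nonneg _)]
  gcongr
  exact norm_exp_sub_one_le_min _

theorem lintegral_steinKernel_mul_le {θ : ℝ} (hθ : θ ∈ Ioo (0 : ℝ) 1) {f : ℝ × ℝ → ℂ}
    (hf : Integrable f) (hf2 : MemLp f 2) :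
    ∫⁻ ζ : ℝ × ℝ, ∫⁻ h : ℝ, ‖FT f ζ - FT f (ζ.1 + h, ζ.2)‖ₑ ^ 2 *
        ENNReal.ofReal ((|h| ^ (1 + 2 * θ))⁻¹) ≤
      ENNReal.ofReal ((2 * π) ^ 2) * (∫⁻ h, ENNReal.ofReal (steinKernel θ 1 h)) *
        ∫⁻ p : ℝ × ℝ, ENNReal.ofReal (|p.1| ^ (2 * θ)) * ‖f p‖ₑ ^ 2 := by
  have hc := continuous_FT hf
  have hfm : AEMeasurable (fun p => ‖f p‖ₑ ^ 2) := hf.1.enorm.pow_const 2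
  have hk : Measurable fun q : ℝ × (ℝ × ℝ) => ENNReal.ofReal (steinKernel θ q.2.1 q.1) :=
    ((measurable_steinKernel θ).comp (measurable_snd.fst.prodMk measurable_fst)).ennreal_ofReal
  calc
    _ = ∫⁻ h : ℝ, ∫⁻ ζ : ℝ × ℝ, ‖FT f ζ - FT f (ζ.1 + h, ζ.2)‖ₑ ^ 2 *
          ENNReal.ofReal ((|h| ^ (1 + 2 * θ))⁻¹) := by
      refine lintegral_lintegral_swap (Measurable.aemeasurable ?_)
      have hg : Continuous fun q : (ℝ × ℝ) × ℝ => FT f q.1 - FT f (q.1.1 + q.2, q.1.2) := by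
        fun_prop
      have hh : Measurable fun q : (ℝ × ℝ) × ℝ => ENNReal.ofReal ((|q.2| ^ (1 + 2 * θ))⁻¹) := by
        fun_prop
      exact (hg.measurable.enorm.pow_const 2).mul hh
    _ ≤ ∫⁻ h : ℝ, ENNReal.ofReal ((2 * π) ^ 2) * ∫⁻ p : ℝ × ℝ,
          ENNReal.ofReal (steinKernel θ p.1 h) * ‖f p‖ₑ ^ 2 := by
      refine lintegral_mono fun h => ?_
      rw [lintegral_mul_const' _ _ ENNReal.ofReal_ne_top]
      refine (mul_le_mul_left (lintegral_FT_sub_translate_le hf hf2 h) _).trans (le_of_eq ?_)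
      rw [mul_assoc, ← lintegral_mul_const' _ _ ENNReal.ofReal_ne_top]
      congr 2
      funext p
      rw [mul_right_comm, ← ENNReal.ofReal_mul (by positivity), ← div_eq_mul_inv, steinKernel]
    _ = ENNReal.ofReal ((2 * π) ^ 2) * ∫⁻ p : ℝ × ℝ, (∫⁻ h : ℝ,
          ENNReal.ofReal (steinKernel θ p.1 h)) * ‖f p‖ₑ ^ 2 := by
      rw [lintegral_const_mul' _ _ ENNReal.ofReal_ne_top, lintegral_lintegral_swap]
      · congr 2
        funext p
        rw [lintegral_mul_const' _ _ (by finiteness)]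
      · exact hk.aemeasurable.mul (hfm.comp_quasiMeasurePreserving
          Measure.quasiMeasurePreserving_snd)
    _ ≤ ENNReal.ofReal ((2 * π) ^ 2) * ∫⁻ p : ℝ × ℝ,
          (∫⁻ h, ENNReal.ofReal (steinKernel θ 1 h)) *
            (ENNReal.ofReal (|p.1| ^ (2 * θ)) * ‖f p‖ₑ ^ 2) := by
      refine mul_le_mul_right (lintegral_mono fun p => ?_) _
      rw [← mul_assoc, mul_comm (∫⁻ h, ENNReal.ofReal (steinKernel θ 1 h))]
      exact mul_le_mul_left (lintegral_steinKernel_le θ _) _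
    _ = _ := by
      rw [lintegral_const_mul' _ _ (lintegral_steinKernel_one_lt_top hθ).ne, mul_assoc]

theorem steinDxi_sq (b : ℝ) (g : ℝ × ℝ → ℂ) (p : ℝ × ℝ) :
    steinDxi b g p ^ 2 =
      ∫⁻ h : ℝ, ENNReal.ofReal (‖g p - g (p.1 + h, p.2)‖ ^ 2 / |h| ^ (1 + 2 * b)) := by
  rw [steinDxi, ← ENNReal.rpow_natCast, ← ENNReal.rpow_mul]
  norm_num
  rw [← lintegral_add_left_eq_self _ p.1]
  simp

theorem stein_integrand_mul_le {C θ : ℝ} {m : ℝ × ℝ → ℂ}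
    (hm : ∀ η, IsBddLipschitz C fun ξ => m (ξ, η)) (g : ℝ × ℝ → ℂ) (ζ : ℝ × ℝ) (h : ℝ) :
    ENNReal.ofReal (‖m ζ * g ζ - m (ζ.1 + h, ζ.2) * g (ζ.1 + h, ζ.2)‖ ^ 2 / |h| ^ (1 + 2 * θ)) ≤
      ENNReal.ofReal (2 * C ^ 2) * (‖g ζ - g (ζ.1 + h, ζ.2)‖ₑ ^ 2 *
          ENNReal.ofReal ((|h| ^ (1 + 2 * θ))⁻¹) +
        ‖g ζ‖ₑ ^ 2 * ENNReal.ofReal (steinKernel θ 1 h)) := by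
  have hC : 0 ≤ C := (hm 0).nonneg
  have hw : 0 ≤ (|h| ^ (1 + 2 * θ))⁻¹ := by positivity
  have hk : 0 ≤ steinKernel θ 1 h := by unfold steinKernel; positivity
  rw [← ofReal_norm, ← ofReal_norm, ← ENNReal.ofReal_pow (norm_nonneg _),
    ← ENNReal.ofReal_pow (norm_nonneg _), ← ENNReal.ofReal_mul (by positivity),
    ← ENNReal.ofReal_mul (by positivity), ← ENNReal.ofReal_add (by positivity) (by positivity),
    ← ENNReal.ofReal_mul (by positivity)]
  refine ENNReal.ofReal_le_ofReal ?_
  have hm1 : ‖m (ζ.1 + h, ζ.2)‖ ≤ C := (hm ζ.2).1 _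
  have hm2 : ‖m ζ - m (ζ.1 + h, ζ.2)‖ ≤ C * min |h| 2 := by
    rw [mul_min_of_nonneg _ _ hC]
    refine le_min ?_ ?_
    · simpa using (hm ζ.2).2 ζ.1 (ζ.1 + h)
    · have : ‖m ζ‖ ≤ C := (hm ζ.2).1 ζ.1
      exact (norm_sub_le _ _).trans (by linarith)
  have hn : ‖m ζ * g ζ - m (ζ.1 + h, ζ.2) * g (ζ.1 + h, ζ.2)‖ ≤
      C * ‖g ζ - g (ζ.1 + h, ζ.2)‖ + C * min |h| 2 * ‖g ζ‖ := by
    rw [show m ζ * g ζ - m (ζ.1 + h, ζ.2) * g (ζ.1 + h, ζ.2) =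
      m (ζ.1 + h, ζ.2) * (g ζ - g (ζ.1 + h, ζ.2)) + (m ζ - m (ζ.1 + h, ζ.2)) * g ζ by ring]
    refine norm_add_le_of_le ?_ ?_ <;> rw [norm_mul] <;> gcongr
  rw [div_eq_mul_inv, steinKernel, mul_one, div_eq_mul_inv, ← mul_assoc (‖g ζ‖ ^ 2), ← add_mul,
    ← mul_assoc]
  refine mul_le_mul_of_nonneg_right ((pow_le_pow_left₀ (norm_nonneg _) hn 2).trans ?_) hw
  nlinarith [sq_nonneg (C * ‖g ζ - g (ζ.1 + h, ζ.2)‖ - C * min |h| 2 * ‖g ζ‖)]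

theorem lintegral_steinDxi_mul_FT_sq_le {C θ : ℝ} (hθ : θ ∈ Ioo (0 : ℝ) 1) {m : ℝ × ℝ → ℂ}
    (hm : ∀ η, IsBddLipschitz C fun ξ => m (ξ, η)) {f : ℝ × ℝ → ℂ}
    (hf : Integrable f) (hf2 : MemLp f 2) :
    ∫⁻ ζ, steinDxi θ (fun ζ => m ζ * FT f ζ) ζ ^ 2 ≤
      ENNReal.ofReal (2 * C ^ 2) * (ENNReal.ofReal ((2 * π) ^ 2) *
        (∫⁻ h, ENNReal.ofReal (steinKernel θ 1 h))) *
        ((∫⁻ p, ‖f p‖ₑ ^ 2) + ∫⁻ p : ℝ × ℝ, ENNReal.ofReal (|p.1| ^ (2 * θ)) * ‖f p‖ₑ ^ 2) := by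
  have hc := continuous_FT hf
  have hk : Measurable fun h => ENNReal.ofReal (steinKernel θ 1 h) :=
    ((measurable_steinKernel θ).comp (measurable_const.prodMk measurable_id)).ennreal_ofReal
  calc
    _ ≤ ∫⁻ ζ : ℝ × ℝ, ∫⁻ h : ℝ, ENNReal.ofReal (2 * C ^ 2) *
          (‖FT f ζ - FT f (ζ.1 + h, ζ.2)‖ₑ ^ 2 * ENNReal.ofReal ((|h| ^ (1 + 2 * θ))⁻¹) +
            ‖FT f ζ‖ₑ ^ 2 * ENNReal.ofReal (steinKernel θ 1 h)) := by
      refine lintegral_mono fun ζ => ?_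
      rw [steinDxi_sq]
      exact lintegral_mono fun h => stein_integrand_mul_le hm _ ζ h
    _ = ENNReal.ofReal (2 * C ^ 2) * ((∫⁻ ζ : ℝ × ℝ, ∫⁻ h : ℝ,
          ‖FT f ζ - FT f (ζ.1 + h, ζ.2)‖ₑ ^ 2 * ENNReal.ofReal ((|h| ^ (1 + 2 * θ))⁻¹)) +
            (∫⁻ ζ, ‖FT f ζ‖ₑ ^ 2) * ∫⁻ h, ENNReal.ofReal (steinKernel θ 1 h)) := by
      simp_rw [lintegral_const_mul' _ _ ENNReal.ofReal_ne_top]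
      have hkm : ∀ ζ, Measurable fun h =>
          ‖FT f ζ‖ₑ ^ 2 * ENNReal.ofReal (steinKernel θ 1 h) := fun ζ => hk.const_mul _
      have hgm : Measurable fun ζ =>
          ‖FT f ζ‖ₑ ^ 2 * ∫⁻ h, ENNReal.ofReal (steinKernel θ 1 h) :=
        (hc.measurable.enorm.pow_const 2).mul_const _
      simp_rw [lintegral_add_right _ (hkm _), lintegral_const_mul _ hk]
      rw [lintegral_add_right _ hgm,
        lintegral_mul_const' _ _ (lintegral_steinKernel_one_lt_top hθ).ne]
    _ ≤ _ := by
      rw [mul_assoc, lintegral_FT_sq hf hf2]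
      refine mul_le_mul_right ?_ _
      refine (add_le_add_left (lintegral_steinKernel_mul_le hθ hf hf2) _).trans (le_of_eq ?_)
      ring

theorem eLpNorm_abs_rpow_mul_sq (θ : ℝ) (f : ℝ × ℝ → ℂ) :
    eLpNorm (fun p : ℝ × ℝ => ((|p.1| ^ θ : ℝ) : ℂ) * f p) 2 volume ^ 2 =
      ∫⁻ p : ℝ × ℝ, ENNReal.ofReal (|p.1| ^ (2 * θ)) * ‖f p‖ₑ ^ 2 := by
  rw [eLpNorm_sq_eq_lintegral]
  refine lintegral_congr fun p => ?_
  rw [enorm_mul, mul_pow, ← ofReal_norm, Complex.norm_real,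
    Real.norm_of_nonneg (by positivity), ← ENNReal.ofReal_pow (by positivity),
    ← Real.rpow_mul_natCast (abs_nonneg _), mul_comm θ]
  norm_num

/-- Lemma 2.13, estimate (2.12): 𝒟^θ_ξ(χ ψ sgn(ξ)^{σ₁} |ξ|^{σ₂} η^{σ₃} f̂) is controlled by
‖f‖ + ‖|x|^θ f‖. -/
theorem steinDxi_cutoff_sgn_pow_bound
    (a θ σ₂ : ℝ) (σ₁ σ₃ : ℕ) (ha : a ∈ Ioo (0 : ℝ) 1) (hθ : θ ∈ Ioo (0 : ℝ) 1)
    (hσ₁ : σ₁ = 0 ∨ σ₁ = 1) (hσ₂ : 1 ≤ σ₂)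
    (ϕ₀ : ℝ → ℝ) (hϕ_smooth : ContDiff ℝ (⊤ : ℕ∞) ϕ₀)
    (hϕ_supp : tsupport ϕ₀ ⊆ Icc (-2 : ℝ) 2)
    (hϕ_one : ∀ x ∈ Ioo (-1 : ℝ) 1, ϕ₀ x = 1)
    (t : ℝ) (ht : 0 ≤ t) :
    ∃ C : ℝ, 0 < C ∧ ∀ f : ℝ × ℝ → ℂ,
      eLpNorm f 2 (volume : Measure (ℝ × ℝ)) < ⊤ →
      eLpNorm (fun p : ℝ × ℝ => ((|p.1| ^ θ : ℝ) : ℂ) * f p) 2 (volume : Measure (ℝ × ℝ)) < ⊤ →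
      steinL2norm θ
          (fun ζ => ((ϕ₀ ζ.1 * ϕ₀ ζ.2 * Real.sign ζ.1 ^ σ₁ * |ζ.1| ^ σ₂ * ζ.2 ^ σ₃ : ℝ) : ℂ) *
            psi a t ζ * FT f ζ) ≤
        ENNReal.ofReal C *
          (eLpNorm f 2 (volume : Measure (ℝ × ℝ)) +
            eLpNorm (fun p : ℝ × ℝ => ((|p.1| ^ θ : ℝ) : ℂ) * f p) 2
              (volume : Measure (ℝ × ℝ))) := by
  obtain ⟨M, hM⟩ := exists_isBddLipschitz_symbol (t := t) ha.1 hσ₂ hσ₁ σ₃ hϕ_smooth hϕ_supp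
  set K : ℝ≥0∞ := ENNReal.ofReal (2 * M ^ 2) * (ENNReal.ofReal ((2 * π) ^ 2) *
    ∫⁻ h, ENNReal.ofReal (steinKernel θ 1 h)) with hK
  have hKtop : K ≠ ⊤ := ENNReal.mul_ne_top ENNReal.ofReal_ne_top
    (ENNReal.mul_ne_top ENNReal.ofReal_ne_top (lintegral_steinKernel_one_lt_top hθ).ne)
  have hKtop' : K ^ (1 / 2 : ℝ) ≠ ⊤ := ENNReal.rpow_ne_top_of_nonneg (by norm_num) hKtop
  refine ⟨(K ^ (1 / 2 : ℝ)).toReal + 1, by positivity, fun f hf hxf => ?_⟩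
  by_cases hi : Integrable f
  · have hf2 : MemLp f 2 := ⟨hi.1, hf⟩
    have hmain := lintegral_steinDxi_mul_FT_sq_le hθ
      (m := fun ζ => ((ϕ₀ ζ.1 * ϕ₀ ζ.2 * Real.sign ζ.1 ^ σ₁ * |ζ.1| ^ σ₂ * ζ.2 ^ σ₃ : ℝ) : ℂ) *
        psi a t ζ) hM hi hf2
    rw [← hK, ← eLpNorm_abs_rpow_mul_sq, ← eLpNorm_sq_eq_lintegral] at hmain
    set X := eLpNorm f 2 (volume : Measure (ℝ × ℝ))
    set Y := eLpNorm (fun p : ℝ × ℝ => ((|p.1| ^ θ : ℝ) : ℂ) * f p) 2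
      (volume : Measure (ℝ × ℝ))
    have hXY : X ^ 2 + Y ^ 2 ≤ (X + Y) ^ 2 := by
      rw [add_sq]
      gcongr
      exact le_self_add
    calc
      _ ≤ (K * (X + Y) ^ 2) ^ (1 / 2 : ℝ) := by
        rw [steinL2norm]
        gcongr
        exact hmain.trans (by gcongr)
      _ = K ^ (1 / 2 : ℝ) * (X + Y) := by
        rw [ENNReal.mul_rpow_of_nonneg _ _ (by norm_num), ← ENNReal.rpow_natCast (X + Y),
          ← ENNReal.rpow_mul]
        norm_num
      _ ≤ _ := by
        gcongr
        rw [ENNReal.le_ofReal_iff_toReal_le hKtop' (by positivity)]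
        linarith
  · simp [steinL2norm, steinDxi, FT_eq_zero_of_not_integrable hi]
end
end
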